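/- Let d ∈ ℤ_{>0} and let z, u, v ∈ F with ν(u) = −d and ν(z), ν(v) > −⌈d/2⌉; set X = [[z√ε, u√ε],[v√ε, z√ε]] and X_u = [[0, u√ε],[0, 0]]. Then Ψ_X(j) = Ψ_{X_u}(j) for all j ∈ J_d, and T(X)·J_d = Z·𝒰·J_d (as subsets of K). -/

import Mathlib

open Matrix

noncomputable section

/-- A 2×2 matrix over `E`. -/
abbrev Mat (E : Type) := Matrix (Fin 2) (Fin 2) E

/-- The context: `E/F` is the unramified quadratic extension of a finite extension `F` of
`ℚ_p` (`p` odd), encoded via the Galois involution `sig` (whose fixed field is `F`),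
the valuation `nu` (normalized by `nu ϖ = 1` for a uniformizer `ϖ` of `F`),
a square root `sqeps` of a non-square unit `eps = sqeps^2` of `O_F`, the residue-field
cardinality `q` of `F`, and an additive character `psi'` of `F` trivial on `p_F` and
nontrivial on `O_F`. -/
structure USetting (E : Type) [Field E] where
  sig : E →+* E
  nu : E → WithTop ℤ
  sqeps : E
  pi : E
  q : ℕ
  psi' : E → ℂ
  sig_invol : ∀ x, sig (sig x) = x
  sig_ne : ∃ x, sig x ≠ x
  nu_eq_top : ∀ x, nu x = ⊤ ↔ x = 0
  nu_mul : ∀ x y, nu (x * y) = nu x + nu y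
  nu_add : ∀ x y, min (nu x) (nu y) ≤ nu (x + y)
  nu_sig : ∀ x, nu (sig x) = nu x
  nu_pi : nu pi = 1
  sig_pi : sig pi = pi
  sig_sqeps : sig sqeps = - sqeps
  nu_sqeps : nu sqeps = 0
  eps_not_square : ∀ y, sig y = y → y * y ≠ sqeps * sqeps
  gen : ∀ x : E, ∃ a b, sig a = a ∧ sig b = b ∧ x = a + b * sqeps
  nu_two : nu 2 = 0
  charzero : ∀ n : ℕ, (n : E) = 0 → n = 0
  complete : ∀ f : ℕ → E, (∀ n : ℕ, ((n : ℤ) : WithTop ℤ) ≤ nu (f (n + 1) - f n)) →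
    ∃ L, ∀ n : ℕ, ((n : ℤ) : WithTop ℤ) ≤ nu (L - f n)
  res_card : ∃ R : Finset E, R.card = q ∧ (∀ x ∈ R, sig x = x ∧ 0 ≤ nu x) ∧
    ∀ y : E, sig y = y → 0 ≤ nu y → ∃! x, x ∈ R ∧ 1 ≤ nu (y - x)
  psi'_mul : ∀ x y, sig x = x → sig y = y → psi' (x + y) = psi' x * psi' y
  psi'_ne : ∀ x, sig x = x → psi' x ≠ 0
  psi'_triv : ∀ x, sig x = x → 1 ≤ nu x → psi' x = 1
  psi'_nontriv : ∃ x, sig x = x ∧ 0 ≤ nu x ∧ psi' x ≠ 1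

variable {E : Type} [Field E]

/-- The matrix `w₀ = [[0,1],[1,0]]`. -/
def w0 (E : Type) [Field E] : Mat E := !![0, 1; 1, 0]

/-- `G = U(1,1)(F)`. -/
def Gset (S : USetting E) : Set (Mat E) :=
  {g | (g.map ⇑S.sig)ᵀ * w0 E * g = w0 E}

/-- `K = G ∩ GL₂(O_E)`: entries in `O_E` and determinant in `O_E^×`. -/
def Kset (S : USetting E) : Set (Mat E) :=
  {g | g ∈ Gset S ∧ (∀ i j, 0 ≤ S.nu (g i j)) ∧ S.nu g.det = 0}

/-- The congruence filtration subgroup `K_n` (for `n ≥ 1`; `K_0 = K` as a set). -/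
def Kfil (S : USetting E) (n : ℤ) : Set (Mat E) :=
  {g | g ∈ Kset S ∧ ∀ i j, (n : WithTop ℤ) ≤ S.nu ((g - 1) i j)}

/-- `𝓑 = B ∩ K`, the upper triangular matrices in `K`. -/
def Bcal (S : USetting E) : Set (Mat E) := {g | g ∈ Kset S ∧ g 1 0 = 0}

/-- `E^1`, the norm-one elements of `E`. -/
def E1set (S : USetting E) : Set E := {x | x * S.sig x = 1}

/-- `O_F^×` as a subset of `E`. -/
def OFunits (S : USetting E) : Set E := {x | S.sig x = x ∧ S.nu x = 0}

/-- `O_E^×` as a subset of `E`. -/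
def OEunits (S : USetting E) : Set E := {x | S.nu x = 0}

/-- A character of `E^×`, encoded as a function `E → ℂ` multiplicative and
nonvanishing on nonzero elements. -/
def IsChar (χ : E → ℂ) : Prop :=
  (∀ x y : E, x ≠ 0 → y ≠ 0 → χ (x * y) = χ x * χ y) ∧ ∀ x : E, x ≠ 0 → χ x ≠ 0

/-- A group homomorphism `E^1 → ℂ^×`, encoded as a function `E → ℂ`. -/
def IsE1Hom (S : USetting E) (φ : E → ℂ) : Prop :=
  (∀ x ∈ E1set S, ∀ y ∈ E1set S, φ (x * y) = φ x * φ y) ∧ ∀ x ∈ E1set S, φ x ≠ 0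

/-- A homomorphism into `ℂ^×` on a subset of matrices. -/
def IsHomOn (A : Set (Mat E)) (Ψ : Mat E → ℂ) : Prop :=
  (∀ x ∈ A, ∀ y ∈ A, Ψ (x * y) = Ψ x * Ψ y) ∧ ∀ x ∈ A, Ψ x ≠ 0

/-- `1 + p_E^n`. -/
def onePE (S : USetting E) (n : ℤ) : Set E := {x | (n : WithTop ℤ) ≤ S.nu (x - 1)}

/-- `1 + p_F^n`. -/
def onePF (S : USetting E) (n : ℤ) : Set E :=
  {x | S.sig x = x ∧ (n : WithTop ℤ) ≤ S.nu (x - 1)}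

/-- `χ` is trivial on a set. -/
def TrivOn (χ : E → ℂ) (s : Set E) : Prop := ∀ x ∈ s, χ x = 1

/-- `χ` has depth `r`: trivial on `1+p_E^{r+1}` and (if `r ≥ 1`) nontrivial on `1+p_E^r`. -/
def HasDepth (S : USetting E) (χ : E → ℂ) (r : ℕ) : Prop :=
  TrivOn χ (onePE S ((r : ℤ) + 1)) ∧ (r = 0 ∨ ¬ TrivOn χ (onePE S (r : ℤ)))

/-- `χ` has true depth `r`: the depth of its restriction to `F^×` is `r`. -/
def HasTrueDepth (S : USetting E) (χ : E → ℂ) (r : ℕ) : Prop :=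
  TrivOn χ (onePF S ((r : ℤ) + 1)) ∧ (r = 0 ∨ ¬ TrivOn χ (onePF S (r : ℤ)))

/-- `χ` has minimal depth `r`: its depth and true depth both equal `r`. -/
def MinDepth (S : USetting E) (χ : E → ℂ) (r : ℕ) : Prop :=
  HasDepth S χ r ∧ HasTrueDepth S χ r

/-- Right translation action on functions. -/
def rho (g : Mat E) : (Mat E → ℂ) →ₗ[ℂ] (Mat E → ℂ) where
  toFun f := fun k => f (k * g)
  map_add' _ _ := rfl
  map_smul' _ _ := rfl

/-- The space `V_χ^{K_n}`: functions on `K` (extended by zero off `K`) satisfying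
`f(bk) = χ(b₁₁) f(k)` for `b ∈ 𝓑` and right `K_n`-invariance. -/
def Vsp (S : USetting E) (χ : E → ℂ) (n : ℤ) : Submodule ℂ (Mat E → ℂ) where
  carrier := {f | (∀ x, x ∉ Kset S → f x = 0) ∧
    (∀ b ∈ Bcal S, ∀ k ∈ Kset S, f (b * k) = χ (b 0 0) * f k) ∧
    (∀ k ∈ Kset S, ∀ g ∈ Kfil S n, f (k * g) = f k)}
  add_mem' := by
    rintro f g ⟨hf0, hf1, hf2⟩ ⟨hg0, hg1, hg2⟩
    refine ⟨fun x hx => ?_, fun b hb k hk => ?_, fun k hk g' hg' => ?_⟩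
    · simp [hf0 x hx, hg0 x hx]
    · simp only [Pi.add_apply, hf1 b hb k hk, hg1 b hb k hk]; ring
    · simp only [Pi.add_apply, hf2 k hk g' hg', hg2 k hk g' hg']
  zero_mem' := by
    refine ⟨fun x _ => rfl, fun b _ k _ => by simp, fun k _ g _ => rfl⟩
  smul_mem' := by
    rintro c f ⟨hf0, hf1, hf2⟩
    refine ⟨fun x hx => ?_, fun b hb k hk => ?_, fun k hk g' hg' => ?_⟩
    · simp [hf0 x hx]
    · simp only [Pi.smul_apply, hf1 b hb k hk, smul_eq_mul]; ring
    · simp only [Pi.smul_apply, hf2 k hk g' hg']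

/-- The space of the representation induced from a character `Ψ` of a subgroup `H ⊆ K`:
functions on `K` (extended by zero) with `f(hk) = Ψ(h) f(k)`. -/
def IndSp (S : USetting E) (H : Set (Mat E)) (Ψ : Mat E → ℂ) : Submodule ℂ (Mat E → ℂ) where
  carrier := {f | (∀ x, x ∉ Kset S → f x = 0) ∧
    ∀ h ∈ H, ∀ k ∈ Kset S, f (h * k) = Ψ h * f k}
  add_mem' := by
    rintro f g ⟨hf0, hf1⟩ ⟨hg0, hg1⟩
    refine ⟨fun x hx => ?_, fun h hh k hk => ?_⟩
    · simp [hf0 x hx, hg0 x hx]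
    · simp only [Pi.add_apply, hf1 h hh k hk, hg1 h hh k hk]; ring
  zero_mem' := ⟨fun x _ => rfl, fun h _ k _ => by simp⟩
  smul_mem' := by
    rintro c f ⟨hf0, hf1⟩
    refine ⟨fun x hx => ?_, fun h hh k hk => ?_⟩
    · simp [hf0 x hx]
    · simp only [Pi.smul_apply, hf1 h hh k hk, smul_eq_mul]; ring

/-- The functions constant on `K` and zero off `K`. -/
def ConstSub (S : USetting E) : Submodule ℂ (Mat E → ℂ) where
  carrier := {f | (∀ x, x ∉ Kset S → f x = 0) ∧ ∃ c : ℂ, ∀ k ∈ Kset S, f k = c}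
  add_mem' := by
    rintro f g ⟨hf0, c, hc⟩ ⟨hg0, c', hc'⟩
    exact ⟨fun x hx => by simp [hf0 x hx, hg0 x hx],
      c + c', fun k hk => by simp [hc k hk, hc' k hk]⟩
  zero_mem' := ⟨fun x _ => rfl, 0, fun _ _ => rfl⟩
  smul_mem' := by
    rintro a f ⟨hf0, c, hc⟩
    exact ⟨fun x hx => by simp [hf0 x hx], a * c, fun k hk => by simp [hc k hk]⟩

/-- A subspace is `K`-invariant. -/
def KInvariant (S : USetting E) (W : Submodule ℂ (Mat E → ℂ)) : Prop :=
  ∀ g ∈ Kset S, ∀ f ∈ W, rho g f ∈ W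

/-- A subset `A ⊆ K` acts trivially on `W`. -/
def ActsTrivially (S : USetting E) (A : Set (Mat E)) (W : Submodule ℂ (Mat E → ℂ)) : Prop :=
  ∀ g ∈ A, ∀ f ∈ W, rho g f = f

/-- `W` is an irreducible representation of `K`. -/
def IsIrredRep (S : USetting E) (W : Submodule ℂ (Mat E → ℂ)) : Prop :=
  W ≠ ⊥ ∧ KInvariant S W ∧
    ∀ U : Submodule ℂ (Mat E → ℂ), U ≤ W → KInvariant S U → U = ⊥ ∨ U = W

/-- `V` and `W` are isomorphic as representations of `K`. -/
def RepIso (S : USetting E) (V W : Submodule ℂ (Mat E → ℂ)) : Prop :=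
  ∃ e : (Mat E → ℂ) →ₗ[ℂ] (Mat E → ℂ), Set.BijOn ⇑e ↑V ↑W ∧
    ∀ g ∈ Kset S, ∀ f ∈ V, e (rho g f) = rho g (e f)

/-- The space of `ℂ`-linear endomorphisms of `V` commuting with the right-translation
action of `K`, realized inside the function space `↥V → ↥V`. -/
def Commutant (S : USetting E) (V : Submodule ℂ (Mat E → ℂ)) :
    Submodule ℂ (↥V → ↥V) where
  carrier := {T | (∀ x y : ↥V, T (x + y) = T x + T y) ∧
    (∀ (c : ℂ) (x : ↥V), T (c • x) = c • T x) ∧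
    ∀ g ∈ Kset S, ∀ f : ↥V, ∀ h : rho g (f : Mat E → ℂ) ∈ V,
      ((T ⟨rho g (f : Mat E → ℂ), h⟩ : ↥V) : Mat E → ℂ) = rho g ((T f : ↥V) : Mat E → ℂ)}
  add_mem' := by
    rintro T T' ⟨hT1, hT2, hT3⟩ ⟨hT1', hT2', hT3'⟩
    refine ⟨fun x y => ?_, fun c x => ?_, fun g hg f h => ?_⟩
    · simp only [Pi.add_apply, hT1 x y, hT1' x y]; abel
    · simp only [Pi.add_apply, hT2 c x, hT2' c x, smul_add]
    · simp only [Pi.add_apply, Submodule.coe_add, hT3 g hg f h, hT3' g hg f h, map_add]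
  zero_mem' := by
    refine ⟨fun x y => by simp, fun c x => by simp, fun g hg f h => by simp⟩
  smul_mem' := by
    rintro c T ⟨hT1, hT2, hT3⟩
    refine ⟨fun x y => ?_, fun a x => ?_, fun g hg f h => ?_⟩
    · simp only [Pi.smul_apply, hT1 x y, smul_add]
    · simp only [Pi.smul_apply, hT2 a x, smul_comm c a]
    · simp only [Pi.smul_apply, Submodule.coe_smul, hT3 g hg f h, _root_.map_smul]

/-- The additive character `ψ` of `E`, `ψ(x) = ψ'((x + σ(x))/2)`. -/
def psiE (S : USetting E) (x : E) : ℂ := S.psi' ((x + S.sig x) / 2)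

/-- `Ψ_Y(g) = ψ(Tr(Y (g − 1)))`. -/
def PsiC (S : USetting E) (Y g : Mat E) : ℂ := psiE S ((Y * (g - 1)).trace)

/-- The Lie algebra `𝔤 = 𝔲(1,1)(F)`. -/
def gfrak (S : USetting E) : Set (Mat E) :=
  {Y | (Y.map ⇑S.sig)ᵀ * w0 E + w0 E * Y = 0}

/-- The lattice `𝔨_s` of the Lie algebra, where `c = ⌈s⌉`. -/
def kfrakC (S : USetting E) (c : ℤ) : Set (Mat E) :=
  {Y | Y ∈ gfrak S ∧ (c : WithTop ℤ) ≤ S.nu (Y 0 0) ∧ (c : WithTop ℤ) ≤ S.nu (Y 1 1) ∧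
    (∃ t, S.sig t = t ∧ (c : WithTop ℤ) ≤ S.nu t ∧ Y 0 1 = S.sqeps * t) ∧
    (∃ t, S.sig t = t ∧ (c : WithTop ℤ) ≤ S.nu t ∧ Y 1 0 = S.sqeps * t)}

/-- The group `J_d`. -/
def Jgrp (S : USetting E) (d : ℕ) : Set (Mat E) :=
  {g | g ∈ Kset S ∧ ((((d + 1) / 2 : ℕ) : WithTop ℤ) ≤ S.nu (g 0 0 - 1)) ∧
    ((((d + 1) / 2 : ℕ) : WithTop ℤ) ≤ S.nu (g 0 1)) ∧
    ((((d + 1) / 2 : ℕ) : WithTop ℤ) ≤ S.nu (g 1 1 - 1)) ∧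
    (((d / 2 + 1 : ℕ) : WithTop ℤ) ≤ S.nu (g 1 0))}

/-- The centralizer `T(X)` in `K` of `X = [[z√ε, u√ε],[v√ε, z√ε]]`. -/
def TXset (S : USetting E) (u v : E) : Set (Mat E) :=
  {m | m ∈ Kset S ∧ m 1 1 = m 0 0 ∧ m 1 0 = m 0 1 * (u⁻¹ * v)}

/-- The center `Z` of `G`, identified with scalar matrices with entries in `E^1`. -/
def Zset (S : USetting E) : Set (Mat E) := {m | ∃ z ∈ E1set S, m = z • (1 : Mat E)}

/-- `𝒰 = U ∩ K`. -/
def Uset (S : USetting E) : Set (Mat E) :=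
  {m | ∃ b, S.sig b = b ∧ 0 ≤ S.nu b ∧ m = !![1, b * S.sqeps; 0, 1]}

/-- The set of products `T(X)·J_d`. -/
def TXJ (S : USetting E) (u v : E) (d : ℕ) : Set (Mat E) :=
  {x | ∃ t ∈ TXset S u v, ∃ j ∈ Jgrp S d, x = t * j}

/-- The set of products `Z·𝒰·J_d`. -/
def ZUJ (S : USetting E) (d : ℕ) : Set (Mat E) :=
  {x | ∃ z ∈ Zset S, ∃ m ∈ Uset S, ∃ j ∈ Jgrp S d, x = z * m * j}

/-- `X = [[z√ε, u√ε],[v√ε, z√ε]]`. -/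
def Xzuv (S : USetting E) (z u v : E) : Mat E :=
  !![z * S.sqeps, u * S.sqeps; v * S.sqeps, z * S.sqeps]

/-- The nilpotent element `X_δ = [[0, δ√ε],[0,0]]`. -/
def Xdelta (S : USetting E) (δ : E) : Mat E := !![0, δ * S.sqeps; 0, 0]

/-- `W` is a `K`-invariant complement of `V_χ^{K_d}` inside `V_χ^{K_{d+1}}`. -/
def Wcompl (S : USetting E) (χ : E → ℂ) (d : ℕ) (W : Submodule ℂ (Mat E → ℂ)) : Prop :=
  W ≤ Vsp S χ ((d : ℤ) + 1) ∧ KInvariant S W ∧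
    Vsp S χ (d : ℤ) ⊓ W = ⊥ ∧ Vsp S χ (d : ℤ) ⊔ W = Vsp S χ ((d : ℤ) + 1)

namespace USetting

variable (S : USetting E)

lemma nu_zero : S.nu 0 = ⊤ := (S.nu_eq_top 0).2 rfl

lemma nu_one : S.nu 1 = 0 := by
  have h := S.nu_mul 1 1
  have h1 : S.nu 1 ≠ ⊤ := fun h => one_ne_zero ((S.nu_eq_top 1).1 h)
  lift S.nu 1 to ℤ using h1 with k hk
  rw [mul_one, ← hk] at h
  norm_cast at h ⊢
  omega

lemma nu_eq_zero_of_add_self {x : WithTop ℤ} (h : x + x = 0) : x = 0 := by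
  cases x with
  | top => simp at h
  | coe k => norm_cast at h ⊢; omega

lemma nu_neg (x : E) : S.nu (-x) = S.nu x := by
  have h : S.nu (-1) = 0 := by
    apply nu_eq_zero_of_add_self
    rw [← S.nu_mul, neg_mul_neg, one_mul, S.nu_one]
  rw [← neg_one_mul, S.nu_mul, h, zero_add]

variable {S} {n : WithTop ℤ} {x y : E}

lemma le_nu_add (hx : n ≤ S.nu x) (hy : n ≤ S.nu y) : n ≤ S.nu (x + y) :=
  (le_min hx hy).trans (S.nu_add x y)

lemma le_nu_neg (hx : n ≤ S.nu x) : n ≤ S.nu (-x) := by rwa [S.nu_neg]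

lemma le_nu_sub (hx : n ≤ S.nu x) (hy : n ≤ S.nu y) : n ≤ S.nu (x - y) := by
  rw [sub_eq_add_neg]
  exact le_nu_add hx (le_nu_neg hy)

lemma le_nu_mul_left (hx : 0 ≤ S.nu x) (hy : n ≤ S.nu y) : n ≤ S.nu (x * y) := by
  rw [S.nu_mul]
  simpa using add_le_add hx hy

lemma le_nu_mul_right (hx : n ≤ S.nu x) (hy : 0 ≤ S.nu y) : n ≤ S.nu (x * y) := by
  rw [mul_comm]
  exact le_nu_mul_left hy hx

lemma ne_zero_of_nu_eq_zero (hx : S.nu x = 0) : x ≠ 0 := by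
  rintro rfl
  rw [S.nu_zero] at hx
  exact WithTop.top_ne_zero hx

lemma nu_inv_eq_zero (hx : S.nu x = 0) : S.nu x⁻¹ = 0 := by
  have h := S.nu_mul x x⁻¹
  rwa [mul_inv_cancel₀ (ne_zero_of_nu_eq_zero hx), S.nu_one, hx, zero_add, eq_comm] at h

lemma le_nu_div (hx : n ≤ S.nu x) (hy : S.nu y = 0) : n ≤ S.nu (x / y) := by
  rw [div_eq_mul_inv]
  exact le_nu_mul_right hx (nu_inv_eq_zero hy).ge

lemma one_le_nu_of_pos (hx : 0 < S.nu x) : 1 ≤ S.nu x := by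
  cases h : S.nu x with
  | top => exact le_top
  | coe k => rw [h] at hx; norm_cast at hx ⊢

lemma nu_eq_zero_of_add (hx : S.nu (x + y) = 0) (hy : 1 ≤ S.nu y) (h0 : 0 ≤ S.nu x) :
    S.nu x = 0 := by
  by_contra h
  have h1 : 1 ≤ S.nu (x + y) := le_nu_add (one_le_nu_of_pos (lt_of_le_of_ne h0 (Ne.symm h))) hy
  rw [hx] at h1
  exact absurd h1 (by decide)

lemma nu_eq_zero_of_mul_sig_self (hx : x * S.sig x = 1) : S.nu x = 0 := by
  apply nu_eq_zero_of_add_self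
  nth_rw 2 [← S.nu_sig x]
  rw [← S.nu_mul, hx, S.nu_one]

/-- An integral element whose norm is close to `1` is close to an element of norm `1`. -/
lemma exists_mem_E1set_le_nu_sub (hx : 0 ≤ S.nu x)
    (h : n ≤ S.nu (1 - x * S.sig x)) : ∃ z ∈ E1set S, n ≤ S.nu (x - z) := by
  have key : ∀ s : E, s * s = 1 → S.sig s = s → S.nu (x + s) = 0 →
      ∃ z ∈ E1set S, n ≤ S.nu (x - z) := by
    intro s hs hσ hν
    have hν' : S.nu (S.sig x + s) = 0 := by rw [← hν, ← S.nu_sig (x + s), map_add, hσ]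
    have h1 := ne_zero_of_nu_eq_zero hν
    have h2 := ne_zero_of_nu_eq_zero hν'
    refine ⟨s * (x + s) / (S.sig x + s), ?_, ?_⟩
    · change _ * _ = _
      simp only [map_div₀, map_mul, map_add, hσ, S.sig_invol]
      field_simp
      linear_combination hs
    · have : x - s * (x + s) / (S.sig x + s) = -((1 - x * S.sig x) / (S.sig x + s)) := by
        field_simp
        linear_combination -hs
      rw [this]
      exact le_nu_neg (le_nu_div h hν')
  by_cases h1 : S.nu (x + 1) = 0
  · exact key 1 (by ring) (by simp) h1
  · refine key (-1) (by ring) (by simp) ?_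
    have h1' : 1 ≤ S.nu (x + 1) :=
      one_le_nu_of_pos (lt_of_le_of_ne (le_nu_add hx S.nu_one.ge) (Ne.symm h1))
    refine nu_eq_zero_of_add (y := -(x + 1)) ?_ (le_nu_neg h1')
      (le_nu_add hx (le_nu_neg S.nu_one.ge))
    rw [show x + -1 + -(x + 1) = -2 by ring, S.nu_neg, S.nu_two]

end USetting

open USetting

variable {S : USetting E}

lemma nu_det_eq_zero_of_mem_Gset {g : Mat E} (hg : g ∈ Gset S) : S.nu g.det = 0 := by
  have h := congrArg Matrix.det (show (g.map ⇑S.sig)ᵀ * w0 E * g = w0 E from hg)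
  rw [Matrix.det_mul, Matrix.det_mul, Matrix.det_transpose,
    show (g.map ⇑S.sig).det = S.sig g.det from (S.sig.map_det g).symm,
    show (w0 E).det = -1 by simp [w0]] at h
  exact nu_eq_zero_of_mul_sig_self (by linear_combination -h)

lemma mul_mem_Kset {g h : Mat E} (hg : g ∈ Kset S) (hh : h ∈ Kset S) : g * h ∈ Kset S := by
  obtain ⟨hg, hgi, hgd⟩ := hg
  obtain ⟨hh, hhi, hhd⟩ := hh
  refine ⟨?_, fun i j => ?_, ?_⟩
  · change _ = _ at hg hh ⊢
    rw [Matrix.map_mul, Matrix.transpose_mul]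
    calc _ = (h.map ⇑S.sig)ᵀ * ((g.map ⇑S.sig)ᵀ * w0 E * g) * h := by
          simp only [Matrix.mul_assoc]
      _ = w0 E := by rw [hg, hh]
  · rw [Matrix.mul_apply, Fin.sum_univ_two]
    exact le_nu_add (le_nu_mul_left (hgi _ _) (hhi _ _)) (le_nu_mul_left (hgi _ _) (hhi _ _))
  · rw [Matrix.det_mul, S.nu_mul, hgd, hhd, add_zero]

lemma mul_mem_Jgrp {d : ℕ} {g h : Mat E} (hg : g ∈ Jgrp S d) (hh : h ∈ Jgrp S d) :
    g * h ∈ Jgrp S d := by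
  obtain ⟨hgK, hg00, hg01, hg11, hg10⟩ := hg
  obtain ⟨hhK, hh00, hh01, hh11, hh10⟩ := hh
  have hgi := hgK.2.1
  have hhi := hhK.2.1
  refine ⟨mul_mem_Kset hgK hhK, ?_, ?_, ?_, ?_⟩ <;>
    rw [Matrix.mul_apply, Fin.sum_univ_two]
  · rw [show g 0 0 * h 0 0 + g 0 1 * h 1 0 - 1
      = g 0 0 * (h 0 0 - 1) + (g 0 0 - 1) + g 0 1 * h 1 0 by ring]
    exact le_nu_add (le_nu_add (le_nu_mul_left (hgi _ _) hh00) hg00)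
      (le_nu_mul_right hg01 (hhi _ _))
  · exact le_nu_add (le_nu_mul_left (hgi _ _) hh01) (le_nu_mul_right hg01 (hhi _ _))
  · rw [show g 1 0 * h 0 1 + g 1 1 * h 1 1 - 1
      = g 1 1 * (h 1 1 - 1) + (g 1 1 - 1) + g 1 0 * h 0 1 by ring]
    exact le_nu_add (le_nu_add (le_nu_mul_left (hgi _ _) hh11) hg11)
      (le_nu_mul_left (hgi _ _) hh01)
  · exact le_nu_add (le_nu_mul_right hg10 (hhi _ _)) (le_nu_mul_left (hgi _ _) hh10)

/-- Defining equations of the unitary group for the matrices `[[a, b], [b w, a]]`. -/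
lemma torus_mem_Gset_iff {a b w : E} (hw : S.sig w = w) :
    !![a, b; b * w, a] ∈ Gset S ↔ (a * S.sig b + S.sig a * b) * w = 0 ∧
      a * S.sig a + b * S.sig b * w = 1 ∧ a * S.sig b + S.sig a * b = 0 := by
  have h1 : !![a, b; b * w, a] ∈ Gset S ↔
      (!![a, b; b * w, a].map ⇑S.sig)ᵀ * w0 E * !![a, b; b * w, a] = w0 E := Iff.rfl
  rw [h1, ← Matrix.ext_iff]
  simp only [w0, Fin.forall_fin_two, Matrix.mul_apply, Fin.sum_univ_two, Matrix.transpose_apply,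
    Matrix.map_apply, Matrix.of_apply, Matrix.cons_val', Matrix.cons_val_zero,
    Matrix.cons_val_one, Matrix.cons_val_fin_one, map_mul, hw]
  constructor
  · rintro ⟨⟨h00, h01⟩, h10, h11⟩
    exact ⟨by linear_combination h00, by linear_combination h01, by linear_combination h11⟩
  · rintro ⟨h00, h01, h11⟩
    exact ⟨⟨by linear_combination h00, by linear_combination h01⟩,
      by linear_combination h01, by linear_combination h11⟩

lemma torus_mem_Kset {a b w : E} (hw : S.sig w = w) (hw0 : 0 ≤ S.nu w) (ha : 0 ≤ S.nu a)
    (hb : 0 ≤ S.nu b) (h1 : a * S.sig a + b * S.sig b * w = 1)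
    (h2 : a * S.sig b + S.sig a * b = 0) : !![a, b; b * w, a] ∈ Kset S := by
  have hG : !![a, b; b * w, a] ∈ Gset S :=
    (torus_mem_Gset_iff hw).2 ⟨by rw [h2, zero_mul], h1, h2⟩
  refine ⟨hG, ?_, nu_det_eq_zero_of_mem_Gset hG⟩
  simp only [Fin.forall_fin_two, Matrix.of_apply, Matrix.cons_val', Matrix.cons_val_zero,
    Matrix.cons_val_one, Matrix.cons_val_fin_one]
  exact ⟨⟨ha, hb⟩, le_nu_mul_left hb hw0, ha⟩

lemma smul_mem_Kset {z : E} (hz : z ∈ E1set S) {g : Mat E} (hg : g ∈ Kset S) :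
    z • g ∈ Kset S := by
  have hz' : z * S.sig z = 1 := hz
  have h := torus_mem_Kset (S := S) (a := z) (b := 0) (w := 0) (by simp) (by simp [S.nu_zero])
    (nu_eq_zero_of_mul_sig_self hz').ge (by simp [S.nu_zero]) (by simpa using hz') (by simp)
  have h' : z • g = !![z, 0; 0 * 0, z] * g := by
    ext i j
    fin_cases i <;> simp [Matrix.mul_apply, Fin.sum_univ_two]
  rw [h']
  exact mul_mem_Kset h hg

lemma unipotent_mem_Kset {b : E} (hb : 0 ≤ S.nu b) (hσ : S.sig b = -b) :
    !![1, b; 0, 1] ∈ Kset S := by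
  have h := torus_mem_Kset (S := S) (a := 1) (b := b) (w := 0) (by simp) (by simp [S.nu_zero])
    S.nu_one.ge hb (by simp) (by simp [hσ])
  rwa [mul_zero] at h

lemma unipotent_mem_Uset {b : E} (hb : 0 ≤ S.nu b) (hσ : S.sig b = -b) :
    !![1, b; 0, 1] ∈ Uset S := by
  have h0 := ne_zero_of_nu_eq_zero S.nu_sqeps
  refine ⟨b / S.sqeps, ?_, le_nu_div hb S.nu_sqeps, ?_⟩
  · rw [map_div₀, hσ, S.sig_sqeps, neg_div_neg_eq]
  · rw [div_mul_cancel₀ _ h0]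

lemma mem_Jgrp_of_le_nu {d : ℕ} {g : Mat E} (hg : g ∈ Kset S)
    (h : ∀ i j, ((d / 2 + 1 : ℕ) : WithTop ℤ) ≤ S.nu ((g - 1) i j)) : g ∈ Jgrp S d := by
  have hle : (((d + 1) / 2 : ℕ) : WithTop ℤ) ≤ ((d / 2 + 1 : ℕ) : WithTop ℤ) := by
    exact Nat.cast_le.2 (by omega)
  refine ⟨hg, hle.trans ?_, hle.trans ?_, hle.trans ?_, ?_⟩
  · simpa using h 0 0
  · simpa using h 0 1
  · simpa using h 1 1
  · simpa using h 1 0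

lemma one_le_natCast_succ (k : ℕ) : (1 : WithTop ℤ) ≤ ((k + 1 : ℕ) : WithTop ℤ) := by
  exact_mod_cast Nat.le_add_left 1 k

/-- Each `[[a, b], [b w, a]] ∈ K` with `w ∈ p_F^{⌈(d+1)/2⌉}` lies in `Z·𝒰·J_d`. -/
lemma torus_mem_ZUJ {d : ℕ} {a b w : E} (hw : S.sig w = w)
    (hwν : ((d / 2 + 1 : ℕ) : WithTop ℤ) ≤ S.nu w) (ht : !![a, b; b * w, a] ∈ Kset S) :
    !![a, b; b * w, a] ∈ ZUJ S d := by
  obtain ⟨-, h1, h2⟩ := (torus_mem_Gset_iff hw).1 ht.1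
  have ha : 0 ≤ S.nu a := by simpa using ht.2.1 0 0
  have hb : 0 ≤ S.nu b := by simpa using ht.2.1 0 1
  have hn := one_le_natCast_succ (d / 2)
  have hbσ : 0 ≤ S.nu (S.sig b) := by rwa [S.nu_sig]
  have hN : ((d / 2 + 1 : ℕ) : WithTop ℤ) ≤ S.nu (1 - a * S.sig a) := by
    rw [show 1 - a * S.sig a = b * S.sig b * w by linear_combination -h1]
    exact le_nu_mul_left (le_nu_mul_left hb hbσ) hwν
  obtain ⟨z, hz, hza⟩ := exists_mem_E1set_le_nu_sub ha hN
  have hz' : z * S.sig z = 1 := hz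
  have hzν := nu_eq_zero_of_mul_sig_self hz'
  have haν : S.nu a = 0 := by
    refine nu_eq_zero_of_add (y := -(a - z)) ?_ (le_nu_neg (hn.trans hza)) ha
    rw [show a + -(a - z) = z by ring, hzν]
  have ha0 := ne_zero_of_nu_eq_zero haν
  have hz0 := ne_zero_of_nu_eq_zero hzν
  have haσ : S.sig a ≠ 0 := ne_zero_of_nu_eq_zero (by rw [S.nu_sig, haν])
  have hβ : 0 ≤ S.nu (b / a) := le_nu_div hb haν
  have hβσ : S.sig (b / a) = -(b / a) := by
    rw [map_div₀]
    field_simp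
    linear_combination h2
  have hzinv : z⁻¹ ∈ E1set S := by
    change _ * _ = _
    rw [map_inv₀, ← mul_inv, hz', inv_one]
  have hprod : z⁻¹ • (!![1, -(b / a); 0, 1] * !![a, b; b * w, a])
      = !![z⁻¹ * (a - b / a * (b * w)), 0; z⁻¹ * (b * w), z⁻¹ * a] := by
    ext i j
    fin_cases i <;> fin_cases j <;> simp
    · left; ring
    · right; field_simp; ring
  have hbw := le_nu_mul_left hb hwν
  have hzi := (nu_inv_eq_zero hzν).ge
  refine ⟨z • 1, ⟨z, hz, rfl⟩, !![1, b / a; 0, 1], unipotent_mem_Uset hβ hβσ,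
    z⁻¹ • (!![1, -(b / a); 0, 1] * !![a, b; b * w, a]), mem_Jgrp_of_le_nu ?_ ?_, ?_⟩
  · exact smul_mem_Kset hzinv (mul_mem_Kset
      (unipotent_mem_Kset (le_nu_neg hβ) (by rw [map_neg, hβσ])) ht)
  · rw [hprod]
    have h11 : z⁻¹ * a - 1 = z⁻¹ * (a - z) := by field_simp
    have h00 : z⁻¹ * (a - b / a * (b * w)) - 1 = z⁻¹ * (a - z - b / a * (b * w)) := by
      field_simp
      ring
    simp only [Fin.forall_fin_two, Matrix.sub_apply, Matrix.of_apply, Matrix.cons_val',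
      Matrix.cons_val_zero, Matrix.cons_val_one, Matrix.cons_val_fin_one, Matrix.one_apply_eq,
      Matrix.one_apply_ne (zero_ne_one (α := Fin 2)), Matrix.one_apply_ne (one_ne_zero (α := Fin 2)),
      sub_zero, S.nu_zero, h11, h00]
    exact ⟨⟨le_nu_mul_left hzi (le_nu_sub hza (le_nu_mul_left hβ hbw)), le_top⟩,
      le_nu_mul_left hzi hbw, le_nu_mul_left hzi hza⟩
  · rw [hprod]
    ext i j
    fin_cases i <;> fin_cases j <;> simp [Matrix.mul_apply, Fin.sum_univ_two] <;>
      field_simp <;> ring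

/-- Up to an element of `J_d`, each element of `𝒰` is of the form `[[a, b], [b w, a]] ∈ K`. -/
lemma exists_unipotent_eq_torus_mul {d : ℕ} {β w : E} (hw : S.sig w = w)
    (hwν : ((d / 2 + 1 : ℕ) : WithTop ℤ) ≤ S.nu w) (hβ : 0 ≤ S.nu β) (hβσ : S.sig β = -β) :
    ∃ a b : E, !![a, b; b * w, a] ∈ Kset S ∧
      ∃ j ∈ Jgrp S d, !![1, β; 0, 1] = !![a, b; b * w, a] * j := by
  have hn := one_le_natCast_succ (d / 2)
  have h20 : (2 : E) ≠ 0 := ne_zero_of_nu_eq_zero S.nu_two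
  have hw0 : 0 ≤ S.nu w := (zero_le_one.trans hn).trans hwν
  have h4 : S.nu (2 * 2) = 0 := by rw [S.nu_mul, S.nu_two, add_zero]
  obtain ⟨δ, hδ⟩ : ∃ δ, δ = β * β * w / (2 * 2) := ⟨_, rfl⟩
  have hδν : ((d / 2 + 1 : ℕ) : WithTop ℤ) ≤ S.nu δ := by
    rw [hδ]
    exact le_nu_div (le_nu_mul_left (le_nu_mul_left hβ hβ) hwν) h4
  have hδσ : S.sig δ = δ := by
    rw [hδ]
    simp [hβσ, hw, map_ofNat]
  have hδβ : β * β * w = 2 * 2 * δ := by rw [hδ]; field_simp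
  have hδ0 : 0 ≤ S.nu δ := (zero_le_one.trans hn).trans hδν
  have hu : S.nu (1 - δ) = 0 :=
    nu_eq_zero_of_add (y := δ) (by rw [sub_add_cancel, S.nu_one]) (hn.trans hδν)
      (le_nu_sub S.nu_one.ge hδ0)
  have hu0 := ne_zero_of_nu_eq_zero hu
  obtain ⟨a, ha⟩ : ∃ a, a = (1 + δ) / (1 - δ) := ⟨_, rfl⟩
  obtain ⟨b, hb⟩ : ∃ b, b = β / (1 - δ) := ⟨_, rfl⟩
  have hσa : S.sig a = a := by rw [ha]; simp [hδσ]
  have hσb : S.sig b = -b := by rw [hb]; simp [hδσ, hβσ, neg_div]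
  have haν : 0 ≤ S.nu a := by
    rw [ha]; exact le_nu_div (le_nu_add S.nu_one.ge hδ0) hu
  have hbν : 0 ≤ S.nu b := by rw [hb]; exact le_nu_div hβ hu
  have hab : a * a - b * b * w = 1 := by
    rw [ha, hb]
    field_simp
    linear_combination -hδβ
  have hK : ∀ b', S.sig b' = -b' → 0 ≤ S.nu b' → b' * b' = b * b →
      !![a, b'; b' * w, a] ∈ Kset S := fun b' hσ hν hbb =>
    torus_mem_Kset hw hw0 haν hν (by rw [hσa, hσ]; linear_combination hab - w * hbb)
      (by rw [hσa, hσ]; ring)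
  refine ⟨a, b, hK b hσb hbν rfl, !![a, -b; -b * w, a] * !![1, β; 0, 1],
    mem_Jgrp_of_le_nu (mul_mem_Kset (hK (-b) (by rw [map_neg, hσb]) (le_nu_neg hbν) (by ring))
      (unipotent_mem_Kset hβ hβσ)) ?_, ?_⟩
  · have hprod : !![a, -b; -b * w, a] * !![1, β; 0, 1]
        = !![a, a * β - b; -(b * w), a - b * w * β] := by
      ext i j
      fin_cases i <;> fin_cases j <;> simp [Matrix.mul_apply, Fin.sum_univ_two] <;> ring
    have ha1 : ((d / 2 + 1 : ℕ) : WithTop ℤ) ≤ S.nu (a - 1) := by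
      rw [show a - 1 = 2 * δ / (1 - δ) by rw [ha]; field_simp; ring]
      exact le_nu_div (le_nu_mul_left S.nu_two.ge hδν) hu
    have hbw := le_nu_mul_left hbν hwν
    rw [hprod]
    simp only [Fin.forall_fin_two, Matrix.sub_apply, Matrix.of_apply, Matrix.cons_val',
      Matrix.cons_val_zero, Matrix.cons_val_one, Matrix.cons_val_fin_one, Matrix.one_apply_eq,
      Matrix.one_apply_ne (zero_ne_one (α := Fin 2)), Matrix.one_apply_ne (one_ne_zero (α := Fin 2)),
      sub_zero]
    refine ⟨⟨ha1, ?_⟩, le_nu_neg hbw, ?_⟩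
    · rw [show a * β - b = β * δ / (1 - δ) by rw [ha, hb]; field_simp; ring]
      exact le_nu_div (le_nu_mul_left hβ hδν) hu
    · rw [show a - b * w * β - 1 = a - 1 - b * w * β by ring]
      exact le_nu_sub ha1 (le_nu_mul_right hbw hβ)
  · rw [← Matrix.mul_assoc, show !![a, b; b * w, a] * !![a, -b; -b * w, a] = 1 by
      ext i j
      fin_cases i <;> fin_cases j <;> simp [Matrix.mul_apply, Fin.sum_univ_two] <;>
        first | linear_combination hab | ring, Matrix.one_mul]

lemma TXJ_eq_ZUJ {u v : E} {d : ℕ} (hw : S.sig (u⁻¹ * v) = u⁻¹ * v)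
    (hwν : ((d / 2 + 1 : ℕ) : WithTop ℤ) ≤ S.nu (u⁻¹ * v)) : TXJ S u v d = ZUJ S d := by
  ext x
  constructor
  · rintro ⟨t, ⟨htK, h11, h10⟩, j, hj, rfl⟩
    have ht : t = !![t 0 0, t 0 1; t 0 1 * (u⁻¹ * v), t 0 0] := by
      rw [← h10]
      exact (Matrix.eta_fin_two t).trans (by rw [h11])
    rw [ht] at htK
    obtain ⟨z, hz, m, hm, j', hj', h⟩ := torus_mem_ZUJ hw hwν htK
    refine ⟨z, hz, m, hm, j' * j, mul_mem_Jgrp hj' hj, ?_⟩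
    rw [ht, h, Matrix.mul_assoc]
  · rintro ⟨_, ⟨z, hz, rfl⟩, _, ⟨b, hb, hbν, rfl⟩, j, hj, rfl⟩
    obtain ⟨a, b', hK, j', hj', h⟩ := exists_unipotent_eq_torus_mul (d := d)
      (β := b * S.sqeps) hw hwν (le_nu_mul_left hbν S.nu_sqeps.ge)
      (by rw [map_mul, hb, S.sig_sqeps, mul_neg])
    refine ⟨z • !![a, b'; b' * (u⁻¹ * v), a], ⟨smul_mem_Kset hz hK, by simp, ?_⟩, j' * j,
      mul_mem_Jgrp hj' hj, ?_⟩
    · simp [mul_assoc]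
    · rw [h, Matrix.smul_mul, Matrix.one_mul, Matrix.smul_mul, Matrix.smul_mul, Matrix.mul_assoc]

lemma one_le_nu_mul {c : ℕ} {x y : E} (hx : ((-(c : ℤ) : ℤ) : WithTop ℤ) < S.nu x)
    (hy : (c : WithTop ℤ) ≤ S.nu y) : 1 ≤ S.nu (x * y) := by
  rw [S.nu_mul]
  generalize S.nu x = m at *
  generalize S.nu y = n at *
  cases m with
  | top => simp
  | coe m =>
    cases n with
    | top => simp
    | coe n =>
      have hx' : -(c : ℤ) < m := WithTop.coe_lt_coe.1 hx
      have hy' : (c : ℤ) ≤ n := WithTop.coe_le_coe.1 hy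
      exact WithTop.coe_le_coe.2 (show (1 : ℤ) ≤ m + n by omega)

lemma psiE_add_of_one_le_nu (x : E) {r : E} (hr : 1 ≤ S.nu r) :
    psiE S (x + r) = psiE S x := by
  have hσ : ∀ y : E, S.sig ((y + S.sig y) / 2) = (y + S.sig y) / 2 := fun y => by
    simp [S.sig_invol, add_comm, map_ofNat]
  have h : (x + r + S.sig (x + r)) / 2 = (x + S.sig x) / 2 + (r + S.sig r) / 2 := by
    rw [map_add]; ring
  rw [psiE, h, S.psi'_mul _ _ (hσ x) (hσ r), S.psi'_triv _ (hσ r), mul_one, psiE]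
  exact le_nu_div (le_nu_add hr (by rwa [S.nu_sig])) S.nu_two

lemma PsiC_Xzuv_eq {d : ℕ} {z u v : E}
    (hnz : ((-(((d + 1) / 2 : ℕ) : ℤ) : ℤ) : WithTop ℤ) < S.nu z)
    (hnv : ((-(((d + 1) / 2 : ℕ) : ℤ) : ℤ) : WithTop ℤ) < S.nu v) {j : Mat E}
    (hj : j ∈ Jgrp S d) : PsiC S (Xzuv S z u v) j = PsiC S (Xdelta S u) j := by
  obtain ⟨-, h00, h01, h11, -⟩ := hj
  have h : (Xzuv S z u v * (j - 1)).trace = (Xdelta S u * (j - 1)).trace +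
      S.sqeps * (z * (j 0 0 - 1) + v * j 0 1 + z * (j 1 1 - 1)) := by
    rw [Matrix.trace_fin_two, Matrix.trace_fin_two]
    simp only [Xzuv, Xdelta, Matrix.mul_apply, Fin.sum_univ_two]
    simp
    ring
  rw [PsiC, h, psiE_add_of_one_le_nu, PsiC]
  exact le_nu_mul_left S.nu_sqeps.ge (le_nu_add (le_nu_add (one_le_nu_mul hnz h00)
    (one_le_nu_mul hnv h01)) (one_le_nu_mul hnz h11))

lemma le_nu_inv_mul {d : ℕ} {u v : E} (hnu : S.nu u = ((-(d : ℤ) : ℤ) : WithTop ℤ))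
    (hnv : ((-(((d + 1) / 2 : ℕ) : ℤ) : ℤ) : WithTop ℤ) < S.nu v) :
    ((d / 2 + 1 : ℕ) : WithTop ℤ) ≤ S.nu (u⁻¹ * v) := by
  have hu0 : u ≠ 0 := by
    rintro rfl
    rw [S.nu_zero] at hnu
    exact WithTop.top_ne_coe hnu
  have h := S.nu_mul u (u⁻¹ * v)
  rw [mul_inv_cancel_left₀ hu0, hnu] at h
  rw [h] at hnv
  generalize S.nu (u⁻¹ * v) = m at *
  cases m with
  | top => exact le_top
  | coe m =>
    have hnv' : -(((d + 1) / 2 : ℕ) : ℤ) < -(d : ℤ) + m := WithTop.coe_lt_coe.1 hnv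
    exact WithTop.coe_le_coe.2 (show ((d / 2 + 1 : ℕ) : ℤ) ≤ m by omega)

/-- if `ν(u) = −d` and `ν(z), ν(v) > −⌈d/2⌉`, then `Ψ_X = Ψ_{X_u}` on `J_d`
and `T(X)·J_d = Z·𝒰·J_d`. -/
theorem stmt18 (S : USetting E) (d : ℕ) (hd : 0 < d) (z u v : E)
    (hz : S.sig z = z) (hu : S.sig u = u) (hv : S.sig v = v)
    (hnu : S.nu u = ((-(d : ℤ) : ℤ) : WithTop ℤ))
    (hnz : ((-(((d + 1) / 2 : ℕ) : ℤ) : ℤ) : WithTop ℤ) < S.nu z)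
    (hnv : ((-(((d + 1) / 2 : ℕ) : ℤ) : ℤ) : WithTop ℤ) < S.nu v) :
    (∀ j ∈ Jgrp S d, PsiC S (Xzuv S z u v) j = PsiC S (Xdelta S u) j) ∧
    TXJ S u v d = ZUJ S d :=
  ⟨fun _ hj => PsiC_Xzuv_eq hnz hnv hj,
    TXJ_eq_ZUJ (by rw [map_mul, map_inv₀, hu, hv]) (le_nu_inv_mul hnu hnv)⟩
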